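/- Under assumptions (A1) and (A3–A7), with constant step size γ = 1/(2R²√N) for a fixed horizon N ≥ 1 and for every integer p ≥ 1: (i) E‖θ_N − θ*‖^{2p} ≤ [(1/R²)·(3R²‖θ_0 − θ*‖² + 5p)]^p; and (ii) E[(f(θ̄_N) − f(θ*))^p] ≤ [(1/√N)·(3R²‖θ_0 − θ*‖² + 5p)]^p, where θ̄_N = (1/N)·Σ_{k=0}^{N−1} θ_k. -/

import Mathlib

open MeasureTheory

theorem ConvexOn.sub_le_inner_gradient {H : Type*} [NormedAddCommGroup H] [InnerProductSpace ℝ H]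
    [CompleteSpace H] {f : H → ℝ} (hf : ConvexOn ℝ Set.univ f) {x : H}
    (hd : DifferentiableAt ℝ f x) (y : H) :
    f x - f y ≤ inner ℝ (x - y) (gradient f x) := by
  have hconv : ConvexOn ℝ Set.univ (f ∘ AffineMap.lineMap (k := ℝ) x y) := by
    simpa using hf.comp_affineMap (AffineMap.lineMap (k := ℝ) x y)
  have hderiv : HasDerivAt (f ∘ AffineMap.lineMap (k := ℝ) x y)
      (inner ℝ (gradient f x) (y - x)) 0 := by
    have h1 : HasFDerivAt f (InnerProductSpace.toDual ℝ H (gradient f x))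
        (AffineMap.lineMap (k := ℝ) x y 0) := by
      simpa using hd.hasGradientAt.hasFDerivAt
    simpa using h1.comp_hasDerivAt (0 : ℝ) AffineMap.hasDerivAt_lineMap
  have h := hconv.le_slope_of_hasDerivAt (Set.mem_univ 0) (Set.mem_univ 1) one_pos hderiv
  simp only [slope_def_field, Function.comp_apply, AffineMap.lineMap_apply_one,
    AffineMap.lineMap_apply_zero, sub_zero, div_one] at h
  rw [← neg_sub x y, inner_neg_right, real_inner_comm] at h
  linarith

theorem pow_succ_le_add_mul_sub_add_sq {u b w : ℝ} (hu : 0 ≤ u) (hb : 0 ≤ b) (huw : u ≤ w)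
    (hbw : b ≤ w) (q : ℕ) :
    u ^ (q + 1) ≤ b ^ (q + 1) + (q + 1) * b ^ q * (u - b)
      + (q + 1) * q / 2 * w ^ (q - 1) * (u - b) ^ 2 := by
  induction q with
  | zero => simp
  | succ k ih =>
    have hw : 0 ≤ w := hu.trans huw
    have hbk : b ^ k ≤ w ^ k := pow_le_pow_left₀ hb hbw k
    have huk : (k : ℝ) * (u * w ^ (k - 1)) ≤ k * w ^ k := by
      rcases k with _ | k
      · simp
      · simp only [Nat.add_sub_cancel, pow_succ' w k]
        gcongr
    have h1 := mul_le_mul_of_nonneg_left ih hu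
    have h2 : (k + 1 : ℝ) * b ^ k * (u - b) ^ 2 ≤ (k + 1) * w ^ k * (u - b) ^ 2 := by gcongr
    have h3 : (k + 1 : ℝ) / 2 * (u - b) ^ 2 * (k * (u * w ^ (k - 1)))
        ≤ (k + 1 : ℝ) / 2 * (u - b) ^ 2 * (k * w ^ k) := by gcongr
    simp only [Nat.add_sub_cancel]
    push_cast
    simp only [pow_succ] at h1 h2 h3 ⊢
    linarith

/-- The weight multiplying the centred noise `h - g` in the expansion of a power of the iterates. -/
noncomputable def noiseWeight (q : ℕ) (s r h : ℝ) : ℝ :=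
  2 * (q + 1) * (r ^ 2) ^ q
    + (q + 1) * q / 2 * ((r + 2 * s) ^ 2) ^ (q - 1) * (8 * h + 4 * s ^ 2)

theorem le_sq_of_noisy_step {u r s h g : ℝ}
    (hhr : h ≤ s * r) (hg : |g| ≤ s * r) (hu' : u ≤ r ^ 2 + 2 * (h - g) + s ^ 2) :
    u ≤ (r + 2 * s) ^ 2 := by
  have := (abs_le.1 hg).1
  nlinarith [abs_nonneg g, sq_nonneg s]

theorem pow_le_of_noisy_step {u r s h g : ℝ} (hu : 0 ≤ u) (hr : 0 ≤ r) (hs : 0 ≤ s)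
    (hhr : h ≤ s * r) (hg : |g| ≤ s * r)
    (hu' : u ≤ r ^ 2 + 2 * (h - g) + s ^ 2) (q : ℕ) :
    u ^ (q + 1) ≤ (r ^ 2) ^ (q + 1) + (q + 1) * (r ^ 2) ^ q * s ^ 2
      + (q + 1) * q / 2 * ((r + 2 * s) ^ 2) ^ (q - 1) * (4 * s ^ 2 * r ^ 2 + s ^ 4)
      + noiseWeight q s r h * (h - g) := by
  set v := r ^ 2 + 2 * (h - g) + s ^ 2 with hv
  have h1 : u ^ (q + 1) ≤ v ^ (q + 1) := pow_le_pow_left₀ hu hu' _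
  have h2 := pow_succ_le_add_mul_sub_add_sq (hu.trans hu') (sq_nonneg r)
    (le_sq_of_noisy_step hhr hg le_rfl) (by nlinarith [mul_nonneg hr hs]) q
  have h3 : (v - r ^ 2) ^ 2 ≤ 4 * s ^ 2 * r ^ 2 + s ^ 4 + (8 * h + 4 * s ^ 2) * (h - g) := by
    have := sq_le_sq' (abs_le.1 hg).1 (abs_le.1 hg).2
    rw [hv]
    nlinarith [sq_nonneg h]
  have h4 : (q + 1 : ℝ) * q / 2 * ((r + 2 * s) ^ 2) ^ (q - 1) * (v - r ^ 2) ^ 2 ≤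
      (q + 1) * q / 2 * ((r + 2 * s) ^ 2) ^ (q - 1) *
        (4 * s ^ 2 * r ^ 2 + s ^ 4 + (8 * h + 4 * s ^ 2) * (h - g)) := by gcongr
  have h5 : (q + 1 : ℝ) * (r ^ 2) ^ q * (v - r ^ 2)
      = (q + 1) * (r ^ 2) ^ q * (2 * (h - g) + s ^ 2) := by rw [hv]; ring
  rw [noiseWeight]
  linarith

theorem one_add_six_fifths_div_pow_le {p : ℕ} (hp : 1 ≤ p) {k : ℕ} (hk : k ≤ p) :
    (1 + 6 / 5 / (p : ℝ)) ^ k ≤ 4 := by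
  have hp0 : (0 : ℝ) < p := by exact_mod_cast hp
  calc (1 + 6 / 5 / (p : ℝ)) ^ k ≤ (1 + 6 / 5 / (p : ℝ)) ^ p :=
        pow_le_pow_right₀ (le_add_of_nonneg_right (by positivity)) hk
    _ ≤ (Real.exp (6 / 5 / p)) ^ p := by
        gcongr
        rw [add_comm]
        exact Real.add_one_le_exp _
    _ = Real.exp (6 / 5) := by
        rw [← Real.exp_nat_mul]
        congr 1
        field_simp
    _ ≤ 4 := by
        refine le_of_pow_le_pow_left₀ (n := 5) (by norm_num) (by norm_num) ?_
        rw [← Real.exp_nat_mul]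
        have : ((5 : ℕ) : ℝ) * (6 / 5) = (6 : ℕ) * 1 := by norm_num
        rw [this, Real.exp_nat_mul]
        calc Real.exp 1 ^ 6 ≤ 3 ^ 6 := by
              gcongr
              exact (Real.exp_one_lt_d9.trans (by norm_num)).le
          _ ≤ 4 ^ 5 := by norm_num

theorem drift_le {r s V : ℝ} (hV : 0 < V) {q : ℕ}
    (hsV : 20 * (q + 1) ^ 2 * s ^ 2 ≤ V) :
    (q + 1) * (r ^ 2) ^ q * s ^ 2
      + (q + 1) * q / 2 * ((r + 2 * s) ^ 2) ^ (q - 1) * (4 * s ^ 2 * r ^ 2 + s ^ 4)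
      ≤ 10 * (q + 1) ^ 2 * s ^ 2 / V * ((r ^ 2) ^ (q + 1) + V ^ (q + 1)) := by
  set Y := max (r ^ 2) V with hY
  have hY0 : 0 < Y := hV.trans_le (le_max_right _ _)
  have hrY : r ^ 2 ≤ Y := le_max_left _ _
  have hVY : V ≤ Y := le_max_right _ _
  have hq1 : (1 : ℝ) ≤ q + 1 := by linarith [q.cast_nonneg (α := ℝ)]
  have hsY : 20 * (q + 1) ^ 2 * s ^ 2 ≤ Y := hsV.trans hVY
  have hW : (r + 2 * s) ^ 2 ≤ Y * (1 + 6 / 5 / ((q + 1 : ℕ) : ℝ)) := by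
    push_cast
    have h1 : 4 * (r * s) * (q + 1) ≤ Y := by
      refine le_of_pow_le_pow_left₀ two_ne_zero hY0.le ?_
      have : r ^ 2 * (20 * (q + 1) ^ 2 * s ^ 2) ≤ Y * Y := by gcongr
      nlinarith [sq_nonneg (r * s * (q + 1))]
    have h2 : 20 * s ^ 2 * (q + 1) ≤ Y := by nlinarith [sq_nonneg s]
    have h3 : r ^ 2 * (q + 1) ≤ Y * (q + 1) := by gcongr
    have h4 : Y * (1 + 6 / 5 / (q + 1 : ℝ)) = (Y * (q + 1) + 6 / 5 * Y) / (q + 1) := by field_simp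
    rw [h4, le_div_iff₀ (by linarith)]
    nlinarith
  have hs4 : 4 * s ^ 2 * r ^ 2 + s ^ 4 ≤ 81 / 20 * s ^ 2 * Y := by
    have : 20 * s ^ 2 ≤ Y := by 
      nlinarith [mul_nonneg (sq_nonneg s) (sub_nonneg.2 (one_le_pow₀ hq1 (n := 2)))]
    nlinarith [sq_nonneg s]
  have hA : (q + 1 : ℝ) * (r ^ 2) ^ q * s ^ 2 ≤ (q + 1) ^ 2 * Y ^ q * s ^ 2 := by
    have : (q + 1 : ℝ) ≤ (q + 1) ^ 2 := by nlinarith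
    gcongr
  have hB : (q + 1 : ℝ) * q / 2 * ((r + 2 * s) ^ 2) ^ (q - 1) * (4 * s ^ 2 * r ^ 2 + s ^ 4)
      ≤ 9 * (q + 1) ^ 2 * Y ^ q * s ^ 2 := by
    rcases q with _ | k
    · simp only [CharP.cast_eq_zero, mul_zero, zero_div, zero_mul]
      positivity
    simp only [Nat.add_sub_cancel]
    have h4 : (1 + 6 / 5 / ((k + 1 + 1 : ℕ) : ℝ)) ^ k ≤ 4 :=
      one_add_six_fifths_div_pow_le (by lia) (by lia)
    calc _ ≤ (((k + 1 : ℕ) : ℝ) + 1) * (((k + 1 : ℕ) : ℝ) + 1) / 2 * (Y ^ k * 4) *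
          (81 / 20 * s ^ 2 * Y) := by
          gcongr
          · linarith
          · calc ((r + 2 * s) ^ 2) ^ k ≤ (Y * (1 + 6 / 5 / ((k + 1 + 1 : ℕ) : ℝ))) ^ k := by gcongr
              _ ≤ Y ^ k * 4 := by rw [mul_pow]; gcongr
      _ ≤ _ := by
          have : 0 ≤ (((k + 1 : ℕ) : ℝ) + 1) ^ 2 * Y ^ (k + 1) * s ^ 2 := by positivity
          rw [pow_succ Y k] at this ⊢
          nlinarith
  have hC : Y ^ q * V ≤ (r ^ 2) ^ (q + 1) + V ^ (q + 1) := by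
    calc Y ^ q * V ≤ Y ^ (q + 1) := by rw [pow_succ]; gcongr
      _ ≤ _ := by
        rcases max_choice (r ^ 2) V with h | h <;> rw [hY, h]
        · exact le_add_of_nonneg_right (by positivity)
        · exact le_add_of_nonneg_left (by positivity)
  calc _ ≤ 10 * (q + 1) ^ 2 * s ^ 2 / V * (Y ^ q * V) := by
        rw [show 10 * (q + 1 : ℝ) ^ 2 * s ^ 2 / V * (Y ^ q * V)
          = 10 * (q + 1 : ℝ) ^ 2 * s ^ 2 * Y ^ q by field_simp]
        linarith
    _ ≤ _ := by gcongr

theorem moment_step_le_pow {m V s : ℝ} (hV : 0 < V) {q : ℕ} (hm : m ≤ V ^ (q + 1)) :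
    m + 10 * (q + 1) ^ 2 * s ^ 2 / V * (m + V ^ (q + 1)) ≤ (V + 20 * (q + 1) * s ^ 2) ^ (q + 1) := by
  have h1 : m + 10 * (q + 1) ^ 2 * s ^ 2 / V * (m + V ^ (q + 1)) ≤
      V ^ (q + 1) + 10 * (q + 1) ^ 2 * s ^ 2 / V * (V ^ (q + 1) + V ^ (q + 1)) := by gcongr
  refine h1.trans ?_
  have hx : 0 ≤ 20 * (q + 1) * s ^ 2 / V := by positivity
  have h2 := one_add_mul_le_pow (a := 20 * (q + 1) * s ^ 2 / V) (by linarith) (q + 1)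
  have h3 := mul_le_mul_of_nonneg_left h2 (pow_pos hV (q + 1)).le
  rw [← mul_pow] at h3
  have h4 : V * (1 + 20 * (q + 1) * s ^ 2 / V) = V + 20 * (q + 1) * s ^ 2 := by field_simp
  rw [h4] at h3
  refine le_of_eq_of_le ?_ h3
  push_cast
  field_simp
  ring

theorem noiseWeight_nonneg (q : ℕ) (s r : ℝ) {h : ℝ} (hh : 0 ≤ h) : 0 ≤ noiseWeight q s r h := by
  unfold noiseWeight
  positivity

theorem noiseWeight_le (q : ℕ) {s r h c : ℝ} (hs : 0 ≤ s) (hr : 0 ≤ r) (hrc : r ≤ c)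
    (hh : 0 ≤ h) (hhr : h ≤ s * r) : noiseWeight q s r h ≤ noiseWeight q s c (s * c) := by
  have : h ≤ s * c := hhr.trans (by gcongr)
  unfold noiseWeight
  gcongr

section NoisyDescent

variable {Ω : Type*} {mΩ : MeasurableSpace Ω} {P : Measure Ω}

theorem ae_sqrt_le_of_noisy_steps {A h g : ℕ → Ω → ℝ} {D s : ℝ} (hD : 0 ≤ D) (hs : 0 ≤ s)
    (hA0 : ∀ ω, A 0 ω = D ^ 2) (hA : ∀ n ω, 0 ≤ A n ω)
    (hhA : ∀ n ω, h n ω ≤ s * √(A n ω)) (hgA : ∀ᵐ ω ∂P, ∀ n, |g n ω| ≤ s * √(A n ω))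
    (hstep : ∀ᵐ ω ∂P, ∀ n, A (n + 1) ω ≤ A n ω + 2 * (h n ω - g n ω) + s ^ 2) :
    ∀ᵐ ω ∂P, ∀ n, √(A n ω) ≤ D + 2 * n * s := by
  filter_upwards [hgA, hstep] with ω hg hst n
  induction n with
  | zero => simp [hA0, hD]
  | succ n ih =>
    have h1 : A (n + 1) ω ≤ (√(A n ω) + 2 * s) ^ 2 :=
      le_sq_of_noisy_step (hhA n ω) (hg n) (by rw [Real.sq_sqrt (hA n ω)]; exact hst n)
    have h2 := Real.sqrt_le_sqrt h1
    rw [Real.sqrt_sq (by positivity)] at h2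
    push_cast
    linarith

theorem integral_pow_le_of_noisy_steps [IsProbabilityMeasure P] (ℱ : Filtration ℕ mΩ)
    {A h g : ℕ → Ω → ℝ} {D s : ℝ} (hD : 0 ≤ D) (hs : 0 < s)
    (hAm : ∀ n, StronglyMeasurable[ℱ n] (A n)) (hhm : ∀ n, StronglyMeasurable[ℱ n] (h n))
    (hgm : ∀ n, AEStronglyMeasurable (g n) P)
    (hA0 : ∀ ω, A 0 ω = D ^ 2) (hA : ∀ n ω, 0 ≤ A n ω) (hh : ∀ n ω, 0 ≤ h n ω)
    (hhA : ∀ n ω, h n ω ≤ s * √(A n ω)) (hgA : ∀ᵐ ω ∂P, ∀ n, |g n ω| ≤ s * √(A n ω))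
    (hstep : ∀ᵐ ω ∂P, ∀ n, A (n + 1) ω ≤ A n ω + 2 * (h n ω - g n ω) + s ^ 2)
    (hcond : ∀ (n : ℕ) (Z : Ω → ℝ) (C : ℝ), StronglyMeasurable[ℱ n] Z → (∀ ω, 0 ≤ Z ω) →
      (∀ᵐ ω ∂P, Z ω ≤ C) → ∫ ω, Z ω * (h n ω - g n ω) ∂P ≤ 0) (q n : ℕ) :
    Integrable (fun ω => A n ω ^ (q + 1)) P ∧
      ∫ ω, A n ω ^ (q + 1) ∂P ≤ (3 * D ^ 2 + 20 * n * (q + 1) * s ^ 2) ^ (q + 1) := by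
  have hbd := ae_sqrt_le_of_noisy_steps hD hs.le hA0 hA hhA hgA hstep
  have hAbd : ∀ᵐ ω ∂P, ∀ n, A n ω ≤ (D + 2 * n * s) ^ 2 := by
    filter_upwards [hbd] with ω hω n
    exact (Real.sqrt_le_left (by positivity)).1 (hω n)
  have hint : ∀ n, Integrable (fun ω => A n ω ^ (q + 1)) P := by
    intro n
    refine Integrable.of_bound
      (((hAm n).mono (ℱ.le n)).aestronglyMeasurable.pow _) (((D + 2 * n * s) ^ 2) ^ (q + 1)) ?_
    filter_upwards [hAbd] with ω hω
    rw [Real.norm_of_nonneg (pow_nonneg (hA n ω) _)]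
    exact pow_le_pow_left₀ (hA n ω) (hω n) _
  refine ⟨hint n, ?_⟩
  have hsmall : ∀ n : ℕ, n ≤ q + 1 →
      ∫ ω, A n ω ^ (q + 1) ∂P ≤ (3 * D ^ 2 + 20 * n * (q + 1) * s ^ 2) ^ (q + 1) := by
    intro n hn
    have hn' : (n : ℝ) ≤ q + 1 := by exact_mod_cast hn
    have hle : (D + 2 * n * s) ^ 2 ≤ 3 * D ^ 2 + 20 * n * (q + 1) * s ^ 2 := by
      have : n * s ^ 2 * n ≤ n * s ^ 2 * (q + 1) := by gcongr
      nlinarith [sq_nonneg (D - n * s), sq_nonneg (n * s)]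
    calc ∫ ω, A n ω ^ (q + 1) ∂P
        ≤ ∫ _, (3 * D ^ 2 + 20 * n * (q + 1) * s ^ 2) ^ (q + 1) ∂P := by
          refine integral_mono_ae (hint n) (integrable_const _) ?_
          filter_upwards [hAbd] with ω hω
          exact pow_le_pow_left₀ (hA n ω) ((hω n).trans hle) _
      _ = _ := by simp
  induction n with
  | zero => exact hsmall 0 (Nat.zero_le _)
  | succ n ih =>
    rcases Nat.lt_or_ge n (q + 1) with hn | hn
    · exact hsmall (n + 1) hn
    set V := 3 * D ^ 2 + 20 * n * (q + 1) * s ^ 2 with hVdef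
    have hn' : (q + 1 : ℝ) ≤ n := by exact_mod_cast hn
    have hsV : 20 * (q + 1) ^ 2 * s ^ 2 ≤ V := by
      have : (q + 1) * s ^ 2 * (q + 1) ≤ (q + 1) * s ^ 2 * (n : ℝ) := by gcongr
      nlinarith [sq_nonneg D]
    have hV : 0 < V := lt_of_lt_of_le (by positivity) hsV
    set Z : Ω → ℝ := fun ω => noiseWeight q s (√(A n ω)) (h n ω) with hZ
    have hZm : StronglyMeasurable[ℱ n] Z := by
      have := Real.continuous_sqrt.comp_stronglyMeasurable (hAm n)
      have h1 : StronglyMeasurable[ℱ n] fun ω => (√(A n ω), h n ω) := this.prodMk (hhm n)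
      have h2 : Continuous fun x : ℝ × ℝ => noiseWeight q s x.1 x.2 := by
        unfold noiseWeight
        fun_prop
      exact h2.comp_stronglyMeasurable h1
    have hZ0 : ∀ ω, 0 ≤ Z ω := fun ω => noiseWeight_nonneg q s _ (hh n ω)
    have hZle : ∀ᵐ ω ∂P, Z ω ≤ noiseWeight q s (D + 2 * n * s) (s * (D + 2 * n * s)) := by
      filter_upwards [hbd] with ω hω
      exact noiseWeight_le q hs.le (Real.sqrt_nonneg _) (hω n) (hh n ω) (hhA n ω)
    have hdiff : ∀ᵐ ω ∂P, ‖h n ω - g n ω‖ ≤ 2 * (s * (D + 2 * n * s)) := by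
      filter_upwards [hbd, hgA] with ω hω hg
      have h1 : s * √(A n ω) ≤ s * (D + 2 * n * s) := by gcongr; exact hω n
      have h2 := abs_le.1 (hg n)
      have h3 := hhA n ω
      have h4 := hh n ω
      rw [Real.norm_eq_abs, abs_le]
      constructor <;> linarith
    have hZint : Integrable (fun ω => Z ω * (h n ω - g n ω)) P := by
      refine Integrable.bdd_mul (c := noiseWeight q s (D + 2 * n * s) (s * (D + 2 * n * s)))
        (Integrable.of_bound (((hhm n).mono (ℱ.le n)).aestronglyMeasurable.sub (hgm n)) _ hdiff)
        (hZm.mono (ℱ.le n)).aestronglyMeasurable ?_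
      filter_upwards [hZle] with ω hω
      rwa [Real.norm_of_nonneg (hZ0 ω)]
    have hAint := hint n
    have hpt : ∀ᵐ ω ∂P, A (n + 1) ω ^ (q + 1) ≤ A n ω ^ (q + 1)
        + 10 * (q + 1) ^ 2 * s ^ 2 / V * (A n ω ^ (q + 1) + V ^ (q + 1))
        + Z ω * (h n ω - g n ω) := by
      filter_upwards [hgA, hstep] with ω hg hst
      have h1 := pow_le_of_noisy_step (hA (n + 1) ω) (Real.sqrt_nonneg (A n ω)) hs.le
        (hhA n ω) (hg n) (by rw [Real.sq_sqrt (hA n ω)]; exact hst n) q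
      have h2 := drift_le (r := √(A n ω)) hV hsV
      rw [Real.sq_sqrt (hA n ω)] at h1 h2
      linarith
    calc ∫ ω, A (n + 1) ω ^ (q + 1) ∂P
        ≤ ∫ ω, (A n ω ^ (q + 1)
          + 10 * (q + 1) ^ 2 * s ^ 2 / V * (A n ω ^ (q + 1) + V ^ (q + 1))
          + Z ω * (h n ω - g n ω)) ∂P :=
          integral_mono_ae (hint (n + 1)) (by fun_prop) hpt
      _ = (∫ ω, A n ω ^ (q + 1) ∂P)
          + 10 * (q + 1) ^ 2 * s ^ 2 / V * ((∫ ω, A n ω ^ (q + 1) ∂P) + V ^ (q + 1))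
          + ∫ ω, Z ω * (h n ω - g n ω) ∂P := by
          rw [integral_add (by fun_prop) hZint, integral_add hAint (by fun_prop),
            integral_const_mul, integral_add hAint (integrable_const _)]
          simp
      _ ≤ (V + 20 * (q + 1) * s ^ 2) ^ (q + 1) := by
          have h1 := hcond n Z _ hZm hZ0 hZle
          have h2 := moment_step_le_pow (s := s) hV ih
          linarith
      _ = _ := by
          rw [hVdef]
          push_cast
          ring

end NoisyDescent

theorem integral_inner_condExp {Ω H : Type*} {m mΩ : MeasurableSpace Ω} {P : Measure Ω}
    [IsFiniteMeasure P] [NormedAddCommGroup H] [InnerProductSpace ℝ H] [CompleteSpace H]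
    (hm : m ≤ mΩ) {W G : Ω → H} (hW : StronglyMeasurable[m] W) {C : ℝ}
    (hWC : ∀ᵐ ω ∂P, ‖W ω‖ ≤ C) (hG : Integrable G P) :
    Integrable (fun ω => inner ℝ (W ω) (G ω)) P ∧
    ∫ ω, inner ℝ (W ω) (G ω) ∂P = ∫ ω, inner ℝ (W ω) ((P[G|m]) ω) ∂P := by
  have hint : Integrable (fun ω => inner ℝ (W ω) (G ω)) P := by
    refine (hG.norm.const_mul C).mono'
      ((hW.mono hm).aestronglyMeasurable.inner hG.aestronglyMeasurable) ?_
    filter_upwards [hWC] with ω hω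
    exact (norm_inner_le_norm _ _).trans (by gcongr)
  refine ⟨hint, ?_⟩
  rw [← integral_condExp hm]
  exact integral_congr_ae (condExp_bilin_of_aestronglyMeasurable_left (innerSL ℝ)
    hW.aestronglyMeasurable hint hG)

theorem ConvexOn.sub_map_average_le {H : Type*} [AddCommGroup H] [Module ℝ H] {f : H → ℝ}
    (hf : ConvexOn ℝ Set.univ f) {N : ℕ} (hN : 1 ≤ N) (x : ℕ → H) (c : ℝ) :
    N * (f ((N : ℝ)⁻¹ • ∑ k ∈ Finset.range N, x k) - c) ≤ ∑ k ∈ Finset.range N, (f (x k) - c) := by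
  have hN0 : (0 : ℝ) < N := by exact_mod_cast hN
  have h := hf.map_sum_le (t := Finset.range N) (w := fun _ => (N : ℝ)⁻¹) (p := x)
    (fun _ _ => by positivity) (by simp [hN0.ne']) (fun _ _ => Set.mem_univ _)
  rw [← Finset.smul_sum, ← Finset.smul_sum, smul_eq_mul] at h
  have h2 := mul_le_mul_of_nonneg_left h hN0.le
  rw [mul_inv_cancel_left₀ hN0.ne'] at h2
  rw [Finset.sum_sub_distrib]
  simp only [Finset.sum_const, Finset.card_range, nsmul_eq_mul]
  linarith

theorem bach_corollary_boundp
    {H : Type*} [NormedAddCommGroup H] [InnerProductSpace ℝ H] [CompleteSpace H]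
    {Ω : Type*} {mΩ : MeasurableSpace Ω} {P : Measure Ω} [IsProbabilityMeasure P]
    (ℱ : Filtration ℕ mΩ)
    (f : H → ℝ) (F : ℕ → Ω → H → ℝ) (θstar θ0 : H) (R γ : ℝ)
    (θ : ℕ → Ω → H)
    (hR : 0 < R)
    (N : ℕ) (hN : 1 ≤ N)
    (hγ : γ = 1 / (2 * R ^ 2 * Real.sqrt N))
    -- (A1) convexity and differentiability of f
    (hf_conv : ConvexOn ℝ Set.univ f)
    (hf_diff : Differentiable ℝ f)
    -- (A3) attained global minimum
    (hmin : ∀ θ' : H, f θstar ≤ f θ')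
    -- (A4) Lipschitz-continuity of f and the fₙ
    (hf_grad_bound : ∀ θ' : H, ‖gradient f θ'‖ ≤ R)
    (hF_grad_bound : ∀ n : ℕ, ∀ᵐ ω ∂P, ∀ θ' : H, ‖gradient (F n ω) θ'‖ ≤ R)
    (hF_conv : ∀ n ω, ConvexOn ℝ Set.univ (F n ω))
    (hF_diff : ∀ n ω, Differentiable ℝ (F n ω))
    -- (A5) adapted measurability
    (hF_meas : ∀ n : ℕ, ∀ x : H, StronglyMeasurable[ℱ n] (fun ω => F n ω x))
    (hθ_adapted : ∀ n : ℕ, StronglyMeasurable[ℱ n] (θ n))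
    -- (A6) unbiased gradients
    (hunbiased : ∀ n : ℕ, 1 ≤ n →
      P[(fun ω => gradient (F n ω) (θ (n - 1) ω))|ℱ (n - 1)]
        =ᵐ[P] fun ω => gradient f (θ (n - 1) ω))
    -- (A7) stochastic gradient recursion
    (hθ0 : ∀ ω, θ 0 ω = θ0)
    (hrec : ∀ n : ℕ, 1 ≤ n → ∀ ω,
      θ n ω = θ (n - 1) ω - γ • gradient (F n ω) (θ (n - 1) ω))
    (p : ℕ) (hp : 1 ≤ p)
    :
    (∫ ω, ‖θ N ω - θstar‖ ^ (2 * p) ∂P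
        ≤ (1 / R ^ 2 * (3 * R ^ 2 * ‖θ0 - θstar‖ ^ 2 + 5 * p)) ^ p) ∧
    (∫ ω, (f (((N : ℝ))⁻¹ • ∑ k ∈ Finset.range N, θ k ω) - f θstar) ^ p ∂P
        ≤ (1 / Real.sqrt N * (3 * R ^ 2 * ‖θ0 - θstar‖ ^ 2 + 5 * p)) ^ p) := by
  have hN0 : (0 : ℝ) < N := by exact_mod_cast hN
  have hγ0 : 0 < γ := by rw [hγ]; positivity
  set G : ℕ → Ω → H := fun n ω => gradient (F (n + 1) ω) (θ n ω) with hG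
  have hθ : ∀ n ω, θ (n + 1) ω = θ n ω - γ • G n ω := fun n ω => hrec (n + 1) (by lia) ω
  have hGb : ∀ᵐ ω ∂P, ∀ n, ‖G n ω‖ ≤ R := by
    filter_upwards [ae_all_iff.2 hF_grad_bound] with ω hω n
    exact hω _ _
  have hθm : ∀ n, StronglyMeasurable (θ n) := fun n => (hθ_adapted n).mono (ℱ.le n)
  have hGm : ∀ n, StronglyMeasurable (G n) := by
    intro n
    have : G n = fun ω => γ⁻¹ • (θ n ω - θ (n + 1) ω) := by
      ext ω
      rw [hθ, sub_sub_cancel, inv_smul_smul₀ hγ0.ne']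
    rw [this]
    exact ((hθm n).sub (hθm (n + 1))).const_smul _
  have hGint : ∀ n, Integrable (G n) P := fun n =>
    Integrable.of_bound (hGm n).aestronglyMeasurable R (hGb.mono fun ω h => h n)
  have hgap : ∀ x, 0 ≤ f x - f θstar := fun x => sub_nonneg.2 (hmin x)
  have hgrad : ∀ x, f x - f θstar ≤ inner ℝ (x - θstar) (gradient f x) := fun x =>
    hf_conv.sub_le_inner_gradient (hf_diff x) θstar
  set A : ℕ → Ω → ℝ := fun n ω =>
    ‖θ n ω - θstar‖ ^ 2 + 2 * γ * ∑ k ∈ Finset.range n, (f (θ k ω) - f θstar) with hAdef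
  set h : ℕ → Ω → ℝ := fun n ω => γ * (f (θ n ω) - f θstar) with hhdef
  set g : ℕ → Ω → ℝ := fun n ω => γ * inner ℝ (θ n ω - θstar) (G n ω) with hgdef
  have hsum : ∀ n ω, 0 ≤ 2 * γ * ∑ k ∈ Finset.range n, (f (θ k ω) - f θstar) := fun n ω =>
    mul_nonneg (by positivity) (Finset.sum_nonneg fun k _ => hgap _)
  have hA : ∀ n ω, 0 ≤ A n ω := fun n ω => add_nonneg (sq_nonneg _) (hsum n ω)
  have hdist : ∀ n ω, ‖θ n ω - θstar‖ ≤ √(A n ω) := fun n ω =>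
    Real.le_sqrt_of_sq_le (le_add_of_nonneg_right (hsum n ω))
  have hfm : ∀ k n, k ≤ n → StronglyMeasurable[ℱ n] fun ω => f (θ k ω) - f θstar :=
    fun k n hkn => (hf_diff.continuous.comp_stronglyMeasurable
      ((hθ_adapted k).mono (ℱ.mono hkn))).sub stronglyMeasurable_const
  have hδm : ∀ n, StronglyMeasurable[ℱ n] fun ω => θ n ω - θstar := fun n =>
    (hθ_adapted n).sub stronglyMeasurable_const
  have hAm : ∀ n, StronglyMeasurable[ℱ n] (A n) := fun n =>
    ((hδm n).norm.pow 2).add (StronglyMeasurable.const_mul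
      (Finset.stronglyMeasurable_fun_sum _ fun k hk => hfm k n (Finset.mem_range.1 hk).le) _)
  have hhm : ∀ n, StronglyMeasurable[ℱ n] (h n) := fun n => (hfm n n le_rfl).const_mul γ
  have hgm : ∀ n, AEStronglyMeasurable (g n) P := fun n =>
    ((((hδm n).mono (ℱ.le n)).inner (hGm n)).const_mul γ).aestronglyMeasurable
  have hA0 : ∀ ω, A 0 ω = ‖θ0 - θstar‖ ^ 2 := fun ω => by simp [hAdef, hθ0]
  have hh : ∀ n ω, 0 ≤ h n ω := fun n ω => mul_nonneg hγ0.le (hgap _)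
  have hhA : ∀ n ω, h n ω ≤ γ * R * √(A n ω) := by
    intro n ω
    calc h n ω ≤ γ * (‖θ n ω - θstar‖ * ‖gradient f (θ n ω)‖) := by
          simp only [hhdef]
          gcongr
          exact (hgrad _).trans (real_inner_le_norm _ _)
      _ ≤ γ * (√(A n ω) * R) := by
          gcongr
          · exact hdist n ω
          · exact hf_grad_bound _
      _ = _ := by ring
  have hgA : ∀ᵐ ω ∂P, ∀ n, |g n ω| ≤ γ * R * √(A n ω) := by
    filter_upwards [hGb] with ω hω n
    simp only [hgdef]
    rw [abs_mul, abs_of_pos hγ0]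
    calc γ * |inner ℝ (θ n ω - θstar) (G n ω)| ≤ γ * (‖θ n ω - θstar‖ * ‖G n ω‖) := by
          gcongr
          exact abs_real_inner_le_norm _ _
      _ ≤ γ * (√(A n ω) * R) := by
          gcongr
          · exact hdist n ω
          · exact hω n
      _ = _ := by ring
  have hstep : ∀ᵐ ω ∂P, ∀ n, A (n + 1) ω ≤ A n ω + 2 * (h n ω - g n ω) + (γ * R) ^ 2 := by
    filter_upwards [hGb] with ω hω n
    have h1 : θ (n + 1) ω - θstar = (θ n ω - θstar) - γ • G n ω := by rw [hθ]; abel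
    have h2 : ‖γ • G n ω‖ ^ 2 ≤ (γ * R) ^ 2 := by
      rw [norm_smul, Real.norm_of_nonneg hγ0.le]
      gcongr
      exact hω n
    simp only [hAdef, hhdef, hgdef]
    rw [h1, norm_sub_sq_real, inner_smul_right, Finset.sum_range_succ]
    linarith
  have hD : 0 ≤ ‖θ0 - θstar‖ := norm_nonneg _
  have hs : 0 < γ * R := by positivity
  have hbd := ae_sqrt_le_of_noisy_steps hD hs.le hA0 hA hhA hgA hstep
  have hcond : ∀ (n : ℕ) (Z : Ω → ℝ) (C : ℝ), StronglyMeasurable[ℱ n] Z → (∀ ω, 0 ≤ Z ω) →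
      (∀ᵐ ω ∂P, Z ω ≤ C) → ∫ ω, Z ω * (h n ω - g n ω) ∂P ≤ 0 := by
    intro n Z C hZm hZ0 hZC
    by_cases hint : Integrable (fun ω => Z ω * (h n ω - g n ω)) P
    swap
    · rw [integral_undef hint]
    have hG' : P[G n|ℱ n] =ᵐ[P] fun ω => gradient f (θ n ω) := hunbiased (n + 1) (by lia)
    have hG'int : Integrable (fun ω => gradient f (θ n ω)) P :=
      integrable_condExp.congr hG'
    have hWm : StronglyMeasurable[ℱ n] fun ω => Z ω • (θ n ω - θstar) := hZm.smul (hδm n)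
    have hWC : ∀ᵐ ω ∂P, ‖Z ω • (θ n ω - θstar)‖ ≤
        C * (‖θ0 - θstar‖ + 2 * n * (γ * R)) := by
      filter_upwards [hZC, hbd] with ω h1 h2
      rw [norm_smul, Real.norm_of_nonneg (hZ0 ω)]
      exact mul_le_mul h1 ((hdist n ω).trans (h2 n)) (norm_nonneg _) ((hZ0 ω).trans h1)
    obtain ⟨hi1, he1⟩ := integral_inner_condExp (ℱ.le n) hWm hWC (hGint n)
    obtain ⟨hi2, -⟩ := integral_inner_condExp (ℱ.le n) hWm hWC hG'int
    have he : ∫ ω, inner ℝ (Z ω • (θ n ω - θstar)) ((P[G n|ℱ n]) ω) ∂P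
        = ∫ ω, inner ℝ (Z ω • (θ n ω - θstar)) (gradient f (θ n ω)) ∂P := by
      refine integral_congr_ae ?_
      filter_upwards [hG'] with ω hω
      rw [hω]
    calc ∫ ω, Z ω * (h n ω - g n ω) ∂P
        ≤ ∫ ω, γ * (inner ℝ (Z ω • (θ n ω - θstar)) (gradient f (θ n ω))
            - inner ℝ (Z ω • (θ n ω - θstar)) (G n ω)) ∂P := by
          refine integral_mono hint ((hi2.sub hi1).const_mul γ) fun ω => ?_
          simp only [hhdef, hgdef, real_inner_smul_left]
          have := mul_le_mul_of_nonneg_left (hgrad (θ n ω)) (mul_nonneg hγ0.le (hZ0 ω))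
          linarith
      _ = 0 := by
          rw [integral_const_mul, integral_sub hi2 hi1, he1, he, sub_self, mul_zero]
  obtain ⟨q, rfl⟩ : ∃ q, p = q + 1 := ⟨p - 1, by lia⟩
  obtain ⟨hAint, hAle⟩ := integral_pow_le_of_noisy_steps ℱ hD hs hAm hhm hgm hA0 hA hh hhA hgA
    hstep hcond q N
  have hsqN : √(N : ℝ) ^ 2 = N := Real.sq_sqrt hN0.le
  have hsqN0 : 0 < √(N : ℝ) := Real.sqrt_pos.2 hN0
  have hV : 3 * ‖θ0 - θstar‖ ^ 2 + 20 * N * (q + 1) * (γ * R) ^ 2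
      = 1 / R ^ 2 * (3 * R ^ 2 * ‖θ0 - θstar‖ ^ 2 + 5 * (q + 1 : ℕ)) := by
    have : (N : ℝ) * (γ * R) ^ 2 = 1 / (4 * R ^ 2) := by
      rw [hγ, ← hsqN, Real.sqrt_sq hsqN0.le]
      field_simp
      norm_num
    rw [show 20 * N * (q + 1) * (γ * R) ^ 2 = 20 * (q + 1) * (N * (γ * R) ^ 2) by ring, this]
    push_cast
    field_simp
    ring
  rw [hV] at hAle
  constructor
  · refine (integral_mono_of_nonneg (.of_forall fun ω => by positivity) hAint
      (.of_forall fun ω => ?_)).trans hAle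
    simp only [pow_mul]
    exact pow_le_pow_left₀ (sq_nonneg _) (le_add_of_nonneg_right (hsum N ω)) _
  · have hc : 2 * γ * N = √(N : ℝ) / R ^ 2 := by
      rw [hγ]
      nth_rewrite 2 [← hsqN]
      field_simp
    have hpt : ∀ ω, (f ((N : ℝ)⁻¹ • ∑ k ∈ Finset.range N, θ k ω) - f θstar) ^ (q + 1)
        ≤ (R ^ 2 / √(N : ℝ)) ^ (q + 1) * A N ω ^ (q + 1) := by
      intro ω
      rw [← mul_pow]
      refine pow_le_pow_left₀ (hgap _) ?_ _
      have h1 := mul_le_mul_of_nonneg_left (hf_conv.sub_map_average_le hN (fun k => θ k ω)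
        (f θstar)) (by positivity : 0 ≤ 2 * γ)
      rw [← mul_assoc, hc] at h1
      have h2 := h1.trans (le_add_of_nonneg_left (sq_nonneg ‖θ N ω - θstar‖))
      have h3 := mul_le_mul_of_nonneg_left h2 (by positivity : 0 ≤ R ^ 2 / √(N : ℝ))
      refine le_of_eq_of_le ?_ h3
      field_simp
    calc ∫ ω, (f ((N : ℝ)⁻¹ • ∑ k ∈ Finset.range N, θ k ω) - f θstar) ^ (q + 1) ∂P
        ≤ ∫ ω, (R ^ 2 / √(N : ℝ)) ^ (q + 1) * A N ω ^ (q + 1) ∂P :=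
          integral_mono_of_nonneg (.of_forall fun ω => pow_nonneg (hgap _) _)
            (hAint.const_mul _) (.of_forall hpt)
      _ = (R ^ 2 / √(N : ℝ)) ^ (q + 1) * ∫ ω, A N ω ^ (q + 1) ∂P := integral_const_mul _ _
      _ ≤ (R ^ 2 / √(N : ℝ)) ^ (q + 1) *
          (1 / R ^ 2 * (3 * R ^ 2 * ‖θ0 - θstar‖ ^ 2 + 5 * (q + 1 : ℕ))) ^ (q + 1) := by gcongr
      _ = _ := by
          rw [← mul_pow]
          congr 1
          field_simp
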